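/- arXiv:2504.13434 — 2 statements merged into one kernel-verified Lean document; each statement's English description precedes it below -/
import Mathlib

section
/- (Recursion lemma, first criterion.) Let (Z_n)_{n≥0} be a sequence of nonnegative real numbers satisfying Z_{n+1} ≤ K b^n (Z_n^{1+μ₁} + Z_n^{1+μ₂}) for all n ≥ 0, where b > 1, K > 0 and μ₂ ≥ μ₁ > 0. If Z₀ ≤ min{1, (2K)^{−1/μ₁} b^{−1/μ₁²}}, then Z_n → 0 as n → ∞. -/
open Filter

/-- **Recursion lemma, first criterion.**
If a sequence of nonnegative reals satisfies
`Z (n+1) ≤ K * b^n * (Z n ^ (1+μ₁) + Z n ^ (1+μ₂))` with `b > 1`, `K > 0`,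
`μ₂ ≥ μ₁ > 0`, and `Z 0 ≤ min 1 ((2K)^(-1/μ₁) * b^(-1/μ₁²))`,
then `Z n → 0`. -/
theorem stmt10 (Z : ℕ → ℝ) (hZ : ∀ n, 0 ≤ Z n)
    (b K μ₁ μ₂ : ℝ) (hb : 1 < b) (hK : 0 < K) (hμ₁ : 0 < μ₁) (hμ : μ₁ ≤ μ₂)
    (hrec : ∀ n : ℕ, Z (n + 1) ≤ K * b ^ n * (Z n ^ (1 + μ₁) + Z n ^ (1 + μ₂)))
    (h0 : Z 0 ≤ min 1 ((2 * K) ^ (-1 / μ₁) * b ^ (-1 / μ₁ ^ 2))) :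
    Tendsto Z atTop (nhds 0) := by
  set C : ℝ := min 1 ((2 * K) ^ (-1 / μ₁) * b ^ (-1 / μ₁ ^ 2))
  set r : ℝ := b ^ (-1 / μ₁) with hr
  have hb0 : 0 < b := by linarith
  have hC0 : 0 < C := by positivity
  have hC1 : C ≤ 1 := min_le_left _ _
  have hr0 : 0 < r := by positivity
  have hr1 : r < 1 :=
    Real.rpow_lt_one_of_one_lt_of_neg hb (div_neg_of_neg_of_pos (by norm_num) hμ₁)
  have hrμ : r ^ μ₁ = b⁻¹ := by
    rw [hr, ← Real.rpow_mul hb0.le, div_mul_cancel₀ _ hμ₁.ne', Real.rpow_neg_one]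
  have hCμ : 2 * K * C ^ μ₁ ≤ r := by
    have hle : C ^ μ₁ ≤ ((2 * K) ^ (-1 / μ₁) * b ^ (-1 / μ₁ ^ 2)) ^ μ₁ :=
      Real.rpow_le_rpow hC0.le (min_le_right _ _) hμ₁.le
    have hexp : -1 / μ₁ ^ 2 * μ₁ = -1 / μ₁ := by field_simp
    rw [Real.mul_rpow (by positivity) (by positivity), ← Real.rpow_mul (by positivity),
      ← Real.rpow_mul hb0.le, div_mul_cancel₀ _ hμ₁.ne', Real.rpow_neg_one, hexp, ← hr] at hle
    calc 2 * K * C ^ μ₁ ≤ 2 * K * ((2 * K)⁻¹ * r) := by gcongr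
      _ = r := by field_simp
  have hbound : ∀ n, Z n ≤ C * r ^ n := by
    intro n
    induction n with
    | zero => simpa using h0
    | succ n ih =>
      have hle1 : Z n ≤ 1 :=
        ih.trans (mul_le_one₀ hC1 (by positivity) (pow_le_one₀ hr0.le hr1.le))
      have hpow : Z n ^ (1 + μ₂) ≤ Z n ^ (1 + μ₁) :=
        Real.rpow_le_rpow_of_exponent_ge' (hZ n) hle1 (by linarith) (by linarith)
      have hrn : (r ^ n) ^ μ₁ = (b ^ n)⁻¹ := by
        rw [← Real.rpow_pow_comm hr0.le, hrμ, inv_pow]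
      calc Z (n + 1) ≤ K * b ^ n * (Z n ^ (1 + μ₁) + Z n ^ (1 + μ₂)) := hrec n
        _ ≤ K * b ^ n * (Z n ^ (1 + μ₁) + Z n ^ (1 + μ₁)) := by gcongr
        _ = 2 * K * b ^ n * Z n ^ (1 + μ₁) := by ring
        _ ≤ 2 * K * b ^ n * (C * r ^ n) ^ (1 + μ₁) := by
          gcongr
          exact hZ n
        _ = 2 * K * C ^ μ₁ * (C * r ^ n) := by
          rw [Real.rpow_add (by positivity), Real.rpow_one,
            Real.mul_rpow hC0.le (by positivity), hrn]
          field_simp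
        _ ≤ r * (C * r ^ n) := by gcongr
        _ = C * r ^ (n + 1) := by ring
  refine squeeze_zero hZ hbound ?_
  simpa using (tendsto_pow_atTop_nhds_zero_of_lt_one hr0.le hr1).const_mul C
end

section
/- (Recursion lemma, second criterion.) Let (Z_n)_{n≥0} be a sequence of nonnegative real numbers satisfying Z_{n+1} ≤ K b^n (Z_n^{1+μ₁} + Z_n^{1+μ₂}) for all n ≥ 0, where b > 1, K > 0 and μ₂ ≥ μ₁ > 0. If Z₀ ≤ min{(2K)^{−1/μ₁} b^{−1/μ₁²}, (2K)^{−1/μ₂} b^{−1/(μ₁μ₂) − (μ₂−μ₁)/μ₂²}}, then Z_n → 0 as n → ∞. -/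
open Filter

/-- A threshold `x ≤ C ^ (-1/μ) * b ^ e` bounds the first contraction factor `C * x ^ μ`. -/
lemma mul_rpow_le_of_le_rpow_neg_inv_mul {x C b μ e r : ℝ} (hx : 0 ≤ x) (hC : 0 < C) (hb : 1 < b)
    (hμ : 0 < μ) (he : e * μ ≤ r) (h : x ≤ C ^ (-1 / μ) * b ^ e) : C * x ^ μ ≤ b ^ r := by
  have hb0 : 0 < b := by linarith
  calc C * x ^ μ ≤ C * (C ^ (-1 / μ) * b ^ e) ^ μ := by gcongr
    _ = b ^ (e * μ) := by
      rw [Real.mul_rpow (by positivity) (by positivity), ← Real.rpow_mul hC.le,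
        ← Real.rpow_mul hb0.le, div_mul_cancel₀ _ hμ.ne', Real.rpow_neg_one, ← mul_assoc,
        mul_inv_cancel₀ hC.ne', one_mul]
    _ ≤ b ^ r := Real.rpow_le_rpow_of_exponent_le hb.le he

/-- If `z ≤ x * q ^ n` and `q ^ μ ≤ b⁻¹`, the factor `b ^ n` is absorbed by the decay of `z`. -/
lemma pow_mul_rpow_le_of_le_mul_pow {z x q b μ : ℝ} (hz : 0 ≤ z) (hx : 0 ≤ x) (hq : 0 ≤ q)
    (hb : 0 < b) (hμ : 0 ≤ μ) (hqb : q ^ μ ≤ b⁻¹) {n : ℕ} (h : z ≤ x * q ^ n) :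
    b ^ n * z ^ μ ≤ x ^ μ := by
  calc b ^ n * z ^ μ ≤ b ^ n * (x * q ^ n) ^ μ := by gcongr
    _ = b ^ n * (x ^ μ * (q ^ μ) ^ n) := by
      rw [Real.mul_rpow hx (by positivity), Real.rpow_pow_comm hq]
    _ ≤ b ^ n * (x ^ μ * b⁻¹ ^ n) := by gcongr
    _ = x ^ μ := by
      rw [inv_pow, mul_left_comm, mul_inv_cancel₀ (by positivity), mul_one]

/-- **Recursion lemma, second criterion.**
If a sequence of nonnegative reals satisfies
`Z (n+1) ≤ K * b^n * (Z n ^ (1+μ₁) + Z n ^ (1+μ₂))` with `b > 1`, `K > 0`,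
`μ₂ ≥ μ₁ > 0`, and
`Z 0 ≤ min ((2K)^(-1/μ₁) * b^(-1/μ₁²)) ((2K)^(-1/μ₂) * b^(-1/(μ₁μ₂) - (μ₂-μ₁)/μ₂²))`,
then `Z n → 0`. -/
theorem stmt11 (Z : ℕ → ℝ) (hZ : ∀ n, 0 ≤ Z n)
    (b K μ₁ μ₂ : ℝ) (hb : 1 < b) (hK : 0 < K) (hμ₁ : 0 < μ₁) (hμ : μ₁ ≤ μ₂)
    (hrec : ∀ n : ℕ, Z (n + 1) ≤ K * b ^ n * (Z n ^ (1 + μ₁) + Z n ^ (1 + μ₂)))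
    (h0 : Z 0 ≤ min ((2 * K) ^ (-1 / μ₁) * b ^ (-1 / μ₁ ^ 2))
        ((2 * K) ^ (-1 / μ₂) * b ^ (-(1 / (μ₁ * μ₂)) - (μ₂ - μ₁) / μ₂ ^ 2))) :
    Tendsto Z atTop (nhds 0) := by
  have hb0 : 0 < b := by linarith
  have hμ₂ : 0 < μ₂ := hμ₁.trans_le hμ
  obtain ⟨h1, h2⟩ := le_min_iff.mp h0
  set q : ℝ := b ^ (-1 / μ₁) with hq
  have hq0 : 0 < q := by positivity
  have hq1 : q < 1 :=
    Real.rpow_lt_one_of_one_lt_of_neg hb (div_neg_of_neg_of_pos (by norm_num) hμ₁)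
  have hqμ₁ : q ^ μ₁ ≤ b⁻¹ := by
    rw [hq, ← Real.rpow_mul hb0.le, div_mul_cancel₀ _ hμ₁.ne', Real.rpow_neg_one]
  have hqμ₂ : q ^ μ₂ ≤ b⁻¹ := (Real.rpow_le_rpow_of_exponent_ge hq0 hq1.le hμ).trans hqμ₁
  have hK₁ : 2 * K * Z 0 ^ μ₁ ≤ q := by
    refine mul_rpow_le_of_le_rpow_neg_inv_mul (hZ 0) (by positivity) hb hμ₁ (le_of_eq ?_) h1
    field_simp
  have hK₂ : 2 * K * Z 0 ^ μ₂ ≤ q := by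
    refine mul_rpow_le_of_le_rpow_neg_inv_mul (hZ 0) (by positivity) hb hμ₂ ?_ h2
    have hexp : (-(1 / (μ₁ * μ₂)) - (μ₂ - μ₁) / μ₂ ^ 2) * μ₂ = -1 / μ₁ - (μ₂ - μ₁) / μ₂ := by
      field_simp
    have hnonneg : 0 ≤ (μ₂ - μ₁) / μ₂ := div_nonneg (sub_nonneg.mpr hμ) hμ₂.le
    linarith
  have hdecay : ∀ n, Z n ≤ Z 0 * q ^ n := by
    intro n
    induction n with
    | zero => simp
    | succ n ih =>
      have e1 := pow_mul_rpow_le_of_le_mul_pow (hZ n) (hZ 0) hq0.le hb0 hμ₁.le hqμ₁ ih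
      have e2 := pow_mul_rpow_le_of_le_mul_pow (hZ n) (hZ 0) hq0.le hb0 hμ₂.le hqμ₂ ih
      calc Z (n + 1) ≤ K * b ^ n * (Z n ^ (1 + μ₁) + Z n ^ (1 + μ₂)) := hrec n
        _ = Z n * (K * (b ^ n * Z n ^ μ₁ + b ^ n * Z n ^ μ₂)) := by
          rw [Real.rpow_add' (hZ n) (by positivity), Real.rpow_add' (hZ n) (by positivity),
            Real.rpow_one]
          ring
        _ ≤ Z n * (K * (Z 0 ^ μ₁ + Z 0 ^ μ₂)) := by
          have := hZ n
          gcongr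
        _ ≤ Z n * q := mul_le_mul_of_nonneg_left (by linarith) (hZ n)
        _ ≤ Z 0 * q ^ n * q := by gcongr
        _ = Z 0 * q ^ (n + 1) := by rw [pow_succ, mul_assoc]
  refine squeeze_zero hZ hdecay ?_
  simpa using (tendsto_pow_atTop_nhds_zero_of_lt_one hq0.le hq1).const_mul (Z 0)
end
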